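/- arXiv:2503.05329 — 2 statements merged into one kernel-verified Lean document; each statement's English description precedes it below -/
import Mathlib

section
/- Let A and B be unital stably finite C*-algebras. Then the radius of comparison satisfies rc(A ⊕ B) = max{rc(A), rc(B)}. -/
open Filter Topology
open scoped ENNReal

noncomputable section

/-- A tracial state on a unital complex star algebra: a unital positive tracial
linear functional. -/
structure TracialState (A : Type*) [Ring A] [StarRing A] [Algebra ℂ A] where
  toFun : A →ₗ[ℂ] ℂ
  map_one' : toFun 1 = 1
  pos' : ∀ a : A, 0 ≤ (toFun (star a * a)).re ∧ (toFun (star a * a)).im = 0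
  tracial' : ∀ a b : A, toFun (a * b) = toFun (b * a)

variable {A : Type*} [Ring A] [StarRing A] [Algebra ℂ A] [TopologicalSpace A]

/-- A matrix over a star ring is positive if it is of the form `c* c`. -/
def IsPositiveEl {n : ℕ} (a : Matrix (Fin n) (Fin n) A) : Prop :=
  ∃ c : Matrix (Fin n) (Fin n) A, a = star c * c

/-- The (non-normalized) extension of a tracial state to matrices. -/
def matTr (τ : TracialState A) {n : ℕ} (M : Matrix (Fin n) (Fin n) A) : ℂ :=
  ∑ i, τ.toFun (M i i)

/-- `IsDTau τ a l` holds if `l = d_τ(a) = lim_k τ(a^{1/k})`, where `a^{1/k}` is the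
(unique) positive `k`-th root of the positive element `a`. -/
def IsDTau (τ : TracialState A) {n : ℕ} (a : Matrix (Fin n) (Fin n) A) (l : ℝ) : Prop :=
  ∃ root : ℕ → Matrix (Fin n) (Fin n) A,
    (∀ k, 1 ≤ k → IsPositiveEl (root k) ∧ root k ^ k = a) ∧
    Tendsto (fun k => (matTr τ (root k)).re) atTop (nhds l)

/-- Cuntz subequivalence for (same-size, after padding by zeros) matrices over `A`:
`a ≾ b` iff there is a sequence `v_k` with `v_k b v_k* → a`. -/
def CuntzSub {n : ℕ} (a b : Matrix (Fin n) (Fin n) A) : Prop :=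
  ∃ v : ℕ → Matrix (Fin n) (Fin n) A,
    Tendsto (fun k => v k * b * star (v k)) atTop (nhds a)

variable (A)

/-- `A` has `r`-comparison if for positive matrices `a, b` over `A`,
`d_τ(a) + r < d_τ(b)` for all tracial states `τ` implies `a ≾ b`. -/
def HasRComparison (r : ℝ) : Prop :=
  ∀ (n : ℕ) (a b : Matrix (Fin n) (Fin n) A), IsPositiveEl a → IsPositiveEl b →
    (∀ (τ : TracialState A) (da db : ℝ), IsDTau τ a da → IsDTau τ b db → da + r < db) →
    CuntzSub a b

/-- The radius of comparison of `A`: the infimum of `r ≥ 0` such that `A` has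
`r`-comparison (`∞` if there is no such `r`). -/
def radiusOfComparison : ℝ≥0∞ :=
  ⨅ (r : {r : ℝ // 0 ≤ r ∧ HasRComparison A r}), ENNReal.ofReal r

/-- `A` is stably finite: one-sided inverses in matrix algebras over `A` are two-sided
(isometries are unitaries). -/
def StablyFinite (A : Type*) [Ring A] [StarRing A] : Prop :=
  ∀ (n : ℕ) (v : Matrix (Fin n) (Fin n) A), star v * v = 1 → v * star v = 1

end

section roots

theorem rcAux_exists_root {M : Type*} [CStarAlgebra M] (c : M) (k : ℕ) (hk : 1 ≤ k) :
    ∃ d : M, (star d * d) ^ k = star c * c := by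
  let _ := CStarAlgebra.spectralOrder M
  let _ := CStarAlgebra.spectralOrderedRing M
  have h0 : 0 ≤ star c * c := star_mul_self_nonneg c
  have hs : 0 ≤ (star c * c) ^ ((k : ℝ)⁻¹) := CFC.rpow_nonneg
  obtain ⟨d, hd⟩ := CStarAlgebra.nonneg_iff_eq_star_mul_self.mp hs
  refine ⟨d, ?_⟩
  rw [← hd, ← CFC.rpow_natCast _ k hs,
    CFC.rpow_rpow_of_exponent_nonneg _ _ _ (by positivity) (by positivity) h0,
    inv_mul_cancel₀ (by positivity), CFC.rpow_one _ h0]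

theorem rcAux_root_unique {M : Type*} [CStarAlgebra M] (c d : M) (k : ℕ) (hk : 1 ≤ k)
    (h : (star c * c) ^ k = (star d * d) ^ k) : star c * c = star d * d := by
  let _ := CStarAlgebra.spectralOrder M
  let _ := CStarAlgebra.spectralOrderedRing M
  have key : ∀ x : M, 0 ≤ x → (x ^ k) ^ ((k : ℝ)⁻¹) = x := by
    intro x hx
    rw [← CFC.rpow_natCast _ k hx,
      CFC.rpow_rpow_of_exponent_nonneg _ _ _ (by positivity) (by positivity) hx,
      mul_inv_cancel₀ (by positivity), CFC.rpow_one _ hx]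
  rw [← key _ (star_mul_self_nonneg c), h, key _ (star_mul_self_nonneg d)]

variable {A : Type*} [NormedRing A] [StarRing A] [CStarRing A]
    [NormedAlgebra ℂ A] [StarModule ℂ A] [CompleteSpace A]

theorem rcAux_mat_exists {n : ℕ} {a : Matrix (Fin n) (Fin n) A} (ha : IsPositiveEl a)
    (k : ℕ) (hk : 1 ≤ k) : ∃ s : Matrix (Fin n) (Fin n) A, IsPositiveEl s ∧ s ^ k = a := by
  let _ : CStarAlgebra A := {}
  let _ := CStarAlgebra.spectralOrder A
  let _ := CStarAlgebra.spectralOrderedRing A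
  obtain ⟨c, rfl⟩ := ha
  let e : Matrix (Fin n) (Fin n) A ≃⋆ₐ[ℂ] CStarMatrix (Fin n) (Fin n) A :=
    CStarMatrix.ofMatrixStarAlgEquiv
  obtain ⟨d, hd⟩ := rcAux_exists_root (e c) k hk
  refine ⟨star (e.symm d) * e.symm d, ⟨_, rfl⟩, ?_⟩
  refine e.injective (?_ : e _ = e _)
  simpa [map_pow, map_mul, map_star] using hd

theorem rcAux_mat_unique {n : ℕ} {s t : Matrix (Fin n) (Fin n) A} (hs : IsPositiveEl s)
    (ht : IsPositiveEl t) (k : ℕ) (hk : 1 ≤ k) (h : s ^ k = t ^ k) : s = t := by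
  let _ : CStarAlgebra A := {}
  let _ := CStarAlgebra.spectralOrder A
  let _ := CStarAlgebra.spectralOrderedRing A
  obtain ⟨c, rfl⟩ := hs
  obtain ⟨d, rfl⟩ := ht
  let e : Matrix (Fin n) (Fin n) A ≃⋆ₐ[ℂ] CStarMatrix (Fin n) (Fin n) A :=
    CStarMatrix.ofMatrixStarAlgEquiv
  have h' := congrArg e h
  refine e.injective (?_ : e _ = e _)
  have := rcAux_root_unique (e c) (e d) k hk (by simpa [map_pow, map_mul, map_star] using h')
  simpa [map_mul, map_star] using this

end roots

section maps

variable {C D : Type*} [Ring C] [StarRing C] [Algebra ℂ C] [Ring D] [StarRing D] [Algebra ℂ D]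

/-- Pull back a tracial state along a unital star homomorphism. -/
def rcAuxPull (τ : TracialState D) (f : C →⋆ₐ[ℂ] D) : TracialState C where
  toFun := τ.toFun ∘ₗ f.toAlgHom.toLinearMap
  map_one' := by simp [τ.map_one']
  pos' a := by simpa [map_mul, map_star] using τ.pos' (f a)
  tracial' a b := by simpa using τ.tracial' (f a) (f b)

theorem rcAux_star_map (f : C →⋆ₐ[ℂ] D) {n : ℕ} (a : Matrix (Fin n) (Fin n) C) :
    (star a).map f = star (a.map f) := by
  ext i j; simp [Matrix.star_apply, map_star]

theorem rcAux_pos_map (f : C →⋆ₐ[ℂ] D) {n : ℕ} {a : Matrix (Fin n) (Fin n) C}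
    (ha : IsPositiveEl a) : IsPositiveEl (a.map f) := by
  obtain ⟨c, rfl⟩ := ha
  exact ⟨c.map f, by rw [Matrix.map_mul, rcAux_star_map]⟩

theorem rcAux_map_pow (f : C →⋆ₐ[ℂ] D) {n : ℕ} (a : Matrix (Fin n) (Fin n) C) (k : ℕ) :
    (a ^ k).map f = (a.map f) ^ k :=
  map_pow (f.toAlgHom.toRingHom.mapMatrix) a k

theorem rcAux_dtau_map (f : C →⋆ₐ[ℂ] D) (τ : TracialState D) {n : ℕ}
    {a : Matrix (Fin n) (Fin n) C} {l : ℝ} (h : IsDTau (rcAuxPull τ f) a l) :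
    IsDTau τ (a.map f) l := by
  obtain ⟨R, hR, hl⟩ := h
  refine ⟨fun k => (R k).map f, fun k hk => ⟨rcAux_pos_map f (hR k hk).1, ?_⟩, ?_⟩
  · rw [← rcAux_map_pow, (hR k hk).2]
  · exact hl

theorem rcAux_cuntz_map [TopologicalSpace C] [TopologicalSpace D]
    (f : C →⋆ₐ[ℂ] D) (hf : Continuous f) {n : ℕ}
    {a b : Matrix (Fin n) (Fin n) C} (h : CuntzSub a b) : CuntzSub (a.map f) (b.map f) := by
  obtain ⟨v, hv⟩ := h
  refine ⟨fun k => (v k).map f, ?_⟩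
  have := ((continuous_id.matrix_map hf).tendsto a).comp hv
  refine this.congr fun k => ?_
  simp [Matrix.map_mul, rcAux_star_map]

end maps

section swap

/-- The swap star homomorphism. -/
def rcAuxSwap (A B : Type*) [Ring A] [StarRing A] [Algebra ℂ A] [Ring B] [StarRing B]
    [Algebra ℂ B] : A × B →⋆ₐ[ℂ] B × A :=
  (StarAlgHom.snd ℂ A B).prod (StarAlgHom.fst ℂ A B)

theorem rcAux_swap {A B : Type*} [NormedRing A] [StarRing A] 
    [NormedAlgebra ℂ A] [NormedRing B] [StarRing B] 
    [NormedAlgebra ℂ B] (r : ℝ) (h : HasRComparison (A × B) r) :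
    HasRComparison (B × A) r := by
  intro n a b ha hb H
  have e : ∀ x : Matrix (Fin n) (Fin n) (B × A),
      (x.map (rcAuxSwap B A)).map (rcAuxSwap A B) = x := fun x => rfl
  have := rcAux_cuntz_map (rcAuxSwap A B) (continuous_snd.prodMk continuous_fst)
    (h n (a.map (rcAuxSwap B A)) (b.map (rcAuxSwap B A)) (rcAux_pos_map _ ha)
      (rcAux_pos_map _ hb) ?_)
  · exact this
  · intro τ da db h1 h2
    refine H (rcAuxPull τ (rcAuxSwap B A)) da db ?_ ?_
    · exact rcAux_dtau_map (rcAuxSwap A B) (rcAuxPull τ (rcAuxSwap B A)) h1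
    · exact rcAux_dtau_map (rcAuxSwap A B) (rcAuxPull τ (rcAuxSwap B A)) h2

end swap

section pair

variable {A B : Type*} [Ring A] [StarRing A] [Algebra ℂ A] [Ring B] [StarRing B] [Algebra ℂ B]

/-- The matrix over the product with given components. -/
def rcAuxPair {n : ℕ} (a : Matrix (Fin n) (Fin n) A) (b : Matrix (Fin n) (Fin n) B) :
    Matrix (Fin n) (Fin n) (A × B) := Matrix.of fun i j => (a i j, b i j)

theorem rcAux_pair_mul {n : ℕ} (a a' : Matrix (Fin n) (Fin n) A)
    (b b' : Matrix (Fin n) (Fin n) B) :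
    rcAuxPair a b * rcAuxPair a' b' = rcAuxPair (a * a') (b * b') := by
  ext i j <;> simp [rcAuxPair, Matrix.mul_apply, Prod.fst_sum, Prod.snd_sum]

theorem rcAux_pair_star {n : ℕ} (a : Matrix (Fin n) (Fin n) A)
    (b : Matrix (Fin n) (Fin n) B) :
    star (rcAuxPair a b) = rcAuxPair (star a) (star b) := by
  ext i j <;> simp [rcAuxPair, Matrix.star_apply]

theorem rcAux_pair_pow {n : ℕ} (a : Matrix (Fin n) (Fin n) A)
    (b : Matrix (Fin n) (Fin n) B) (k : ℕ) :
    (rcAuxPair a b) ^ k = rcAuxPair (a ^ k) (b ^ k) := by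
  induction k with
  | zero => ext i j <;> by_cases h : i = j <;> simp [rcAuxPair, h]
  | succ k ih => rw [pow_succ, ih, rcAux_pair_mul, pow_succ, pow_succ]

theorem rcAux_pair_pos {n : ℕ} {a : Matrix (Fin n) (Fin n) A}
    {b : Matrix (Fin n) (Fin n) B} (ha : IsPositiveEl a) (hb : IsPositiveEl b) :
    IsPositiveEl (rcAuxPair a b) := by
  obtain ⟨c, rfl⟩ := ha
  obtain ⟨d, rfl⟩ := hb
  exact ⟨rcAuxPair c d, by rw [rcAux_pair_star, rcAux_pair_mul]⟩

end pair

section pad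

variable {A : Type*} [Ring A] [StarRing A] [Algebra ℂ A]

/-- Padding by zeros. -/
def rcAuxPad (N : ℕ) {n : ℕ} (a : Matrix (Fin n) (Fin n) A) :
    Matrix (Fin (n + N)) (Fin (n + N)) A :=
  (Matrix.fromBlocks a 0 0 0).submatrix finSumFinEquiv.symm finSumFinEquiv.symm

theorem rcAux_pad_mul (N : ℕ) {n : ℕ} (a b : Matrix (Fin n) (Fin n) A) :
    rcAuxPad N a * rcAuxPad N b = rcAuxPad N (a * b) := by
  simp [rcAuxPad, Matrix.submatrix_mul_equiv, Matrix.fromBlocks_multiply]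

theorem rcAux_pad_star (N : ℕ) {n : ℕ} (a : Matrix (Fin n) (Fin n) A) :
    star (rcAuxPad N a) = rcAuxPad N (star a) := by
  simp [rcAuxPad, Matrix.star_eq_conjTranspose, Matrix.fromBlocks_conjTranspose]

theorem rcAux_pad_pow (N : ℕ) {n : ℕ} (a : Matrix (Fin n) (Fin n) A) (k : ℕ) (hk : 1 ≤ k) :
    (rcAuxPad N a) ^ k = rcAuxPad N (a ^ k) := by
  induction k, hk using Nat.le_induction with
  | base => simp
  | succ k hk ih => rw [pow_succ, ih, rcAux_pad_mul, pow_succ]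

theorem rcAux_pad_pos (N : ℕ) {n : ℕ} {a : Matrix (Fin n) (Fin n) A} (ha : IsPositiveEl a) :
    IsPositiveEl (rcAuxPad N a) := by
  obtain ⟨c, rfl⟩ := ha
  exact ⟨rcAuxPad N c, by rw [rcAux_pad_star, rcAux_pad_mul]⟩

theorem rcAux_corner (N : ℕ) {n : ℕ} (b : Matrix (Fin n) (Fin n) A)
    (v : Matrix (Fin (n + N)) (Fin (n + N)) A) :
    (v * rcAuxPad N b * star v).submatrix (Fin.castAdd N) (Fin.castAdd N) =
      v.submatrix (Fin.castAdd N) (Fin.castAdd N) * b *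
        star (v.submatrix (Fin.castAdd N) (Fin.castAdd N)) := by
  ext i j
  simp [rcAuxPad, Matrix.mul_apply, Fin.sum_univ_add, Matrix.star_apply]

theorem rcAux_cuntz_pad [TopologicalSpace A] (N : ℕ) {n : ℕ} {a b : Matrix (Fin n) (Fin n) A}
    (h : CuntzSub (rcAuxPad N a) (rcAuxPad N b)) : CuntzSub a b := by
  obtain ⟨v, hv⟩ := h
  refine ⟨fun k => (v k).submatrix (Fin.castAdd N) (Fin.castAdd N), ?_⟩
  have hc : Continuous fun M : Matrix (Fin (n + N)) (Fin (n + N)) A =>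
      M.submatrix (Fin.castAdd N) (Fin.castAdd N) := continuous_id.matrix_submatrix _ _
  have := (hc.tendsto (rcAuxPad N a)).comp hv
  have e : (rcAuxPad N a).submatrix (Fin.castAdd N) (Fin.castAdd N) = a := by
    ext i j; simp [rcAuxPad]
  rw [e] at this
  exact this.congr fun k => rcAux_corner N b (v k)

theorem rcAux_matTr_pair {B : Type*} [Ring B] [StarRing B] [Algebra ℂ B]
    (τ : TracialState (A × B)) (N : ℕ) {n : ℕ} (a : Matrix (Fin n) (Fin n) A)
    (x : Matrix (Fin (n + N)) (Fin (n + N)) B) :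
    matTr τ (rcAuxPair (rcAuxPad N a) x) =
      ∑ i, τ.toFun (a i i, 0) + ∑ i, τ.toFun (0, x i i) := by
  have e : ∀ (p : A) (q : B), τ.toFun (p, q) = τ.toFun (p, 0) + τ.toFun (0, q) := by
    intro p q; rw [← map_add]; simp
  have z : τ.toFun (0, 0) = 0 := map_zero τ.toFun
  simp only [matTr, rcAuxPair, Matrix.of_apply]
  rw [Finset.sum_congr rfl fun i _ => e _ _, Finset.sum_add_distrib]
  congr 1
  simp [Fin.sum_univ_add, rcAuxPad, z]

end pad

section main

/-- Normalized restriction of a tracial state on a product to the first factor. -/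
noncomputable def rcAuxRestr {A B : Type*} [Ring A] [StarRing A] [Algebra ℂ A] [Ring B] [StarRing B]
    [Algebra ℂ B] (τ : TracialState (A × B)) (t : ℝ) (ht : 0 < t)
    (h : τ.toFun (1, 0) = (t : ℂ)) : TracialState A where
  toFun := ((t⁻¹ : ℝ) : ℂ) • (τ.toFun ∘ₗ LinearMap.inl ℂ A B)
  map_one' := by
    have : (t : ℂ) ≠ 0 := by exact_mod_cast ht.ne'
    simp [h, this]
  pos' a := by
    have h1 := τ.pos' (a, 0)
    have e : star ((a, 0) : A × B) * (a, 0) = (star a * a, 0) := by ext <;> simp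
    rw [e] at h1
    simp only [LinearMap.smul_apply, LinearMap.comp_apply, LinearMap.inl_apply, smul_eq_mul,
      Complex.re_ofReal_mul, Complex.im_ofReal_mul]
    exact ⟨mul_nonneg (by positivity) h1.1, by rw [h1.2, mul_zero]⟩
  tracial' a b := by
    have h1 := τ.tracial' (a, 0) (b, 0)
    simp only [Prod.mk_mul_mk, mul_zero] at h1
    simp [h1]

theorem rcAux_zero {A B : Type*} [Ring A] [StarRing A] [Algebra ℂ A] [StarModule ℂ A] [Ring B] [StarRing B]
    [Algebra ℂ B] (τ : TracialState (A × B)) (h : τ.toFun (1, 0) = 0) (x : A) :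
    (τ.toFun (star x * x, 0)).re = 0 := by
  have key : ∀ c : ℝ, 0 ≤ (τ.toFun (star (star x * x) * (star x * x), 0)).re
      + c * (2 * (τ.toFun (star x * x, 0)).re) := by
    intro c
    have h1 := (τ.pos' (star x * x + (c : ℂ) • 1, 0)).1
    have e : star ((star x * x + (c : ℂ) • 1, 0) : A × B) * (star x * x + (c : ℂ) • 1, 0) =
        (star (star x * x) * (star x * x), 0) + (2 * c : ℂ) • (star x * x, 0)
          + (c * c : ℂ) • (1, 0) := by
      ext
      · simp only [Prod.fst_mul, Prod.fst_star, Prod.fst_add, Prod.smul_fst, star_add, star_smul,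
          star_one, star_mul, star_star, RCLike.star_def, Complex.conj_ofReal]
        simp only [add_mul, mul_add, smul_mul_assoc, mul_smul_comm, one_mul, mul_one]
        module
      · simp
    rw [e, map_add, map_add, map_smul, map_smul, h, smul_zero, add_zero, smul_eq_mul,
      Complex.add_re] at h1
    have e2 : ((2 * c : ℂ) * τ.toFun (star x * x, 0)).re =
        c * (2 * (τ.toFun (star x * x, 0)).re) := by
      have : (2 * c : ℂ) = ((2 * c : ℝ) : ℂ) := by push_cast; ring
      rw [this, Complex.re_ofReal_mul]; ring
    rwa [e2] at h1
  by_contra hne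
  set p := (τ.toFun (star (star x * x) * (star x * x), 0)).re
  set q := (τ.toFun (star x * x, 0)).re
  have := key (-(p + 1) / (2 * q))
  rw [div_mul_cancel₀ _ (by simpa using hne)] at this
  linarith

theorem rcAux_ineq {A B : Type*} [NormedRing A] [StarRing A] [CStarRing A]
    [NormedAlgebra ℂ A] [StarModule ℂ A] [CompleteSpace A]
    [NormedRing B] [StarRing B] [CStarRing B]
    [NormedAlgebra ℂ B] [StarModule ℂ B] [CompleteSpace B] (r : ℝ) (N : ℕ) (hN : r < N)
    (n : ℕ) (a b : Matrix (Fin n) (Fin n) A) (ha : IsPositiveEl a) (hb : IsPositiveEl b)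
    (H : ∀ (τ : TracialState A) (da db : ℝ), IsDTau τ a da → IsDTau τ b db → da + r < db)
    (τ : TracialState (A × B)) (da db : ℝ)
    (hda : IsDTau τ (rcAuxPair (rcAuxPad N a) 0) da)
    (hdb : IsDTau τ (rcAuxPair (rcAuxPad N b) 1) db) : da + r < db := by
  obtain ⟨R, hR, hRl⟩ := hda
  obtain ⟨S, hS, hSl⟩ := hdb
  -- the weight of the first summand
  obtain ⟨t, ht0, ht⟩ : ∃ t : ℝ, 0 ≤ t ∧ τ.toFun (1, 0) = (t : ℂ) := by
    have h1 := τ.pos' (1, 0)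
    have e : star ((1, 0) : A × B) * (1, 0) = (1, 0) := by ext <;> simp
    rw [e] at h1
    exact ⟨_, h1.1, Complex.ext rfl (by simpa using h1.2)⟩
  have ht' : τ.toFun (0, 1) = ((1 - t : ℝ) : ℂ) := by
    have h1 := τ.map_one'
    have e : (1 : A × B) = (1, 0) + (0, 1) := by ext <;> simp
    rw [e, map_add, ht] at h1
    push_cast
    rw [← h1]; ring
  have ht1 : 0 ≤ 1 - t := by
    have h1 := (τ.pos' (0, 1)).1
    have e : star ((0, 1) : A × B) * (0, 1) = (0, 1) := by ext <;> simp
    rw [e, ht', Complex.ofReal_re] at h1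
    exact h1
  -- roots of `a` and `b`
  have ra : ∀ k, ∃ s : Matrix (Fin n) (Fin n) A, 1 ≤ k → IsPositiveEl s ∧ s ^ k = a := by
    intro k
    by_cases hk : 1 ≤ k
    · obtain ⟨s, hs⟩ := rcAux_mat_exists ha k hk
      exact ⟨s, fun _ => hs⟩
    · exact ⟨0, fun h => absurd h hk⟩
  have rb : ∀ k, ∃ s : Matrix (Fin n) (Fin n) A, 1 ≤ k → IsPositiveEl s ∧ s ^ k = b := by
    intro k
    by_cases hk : 1 ≤ k
    · obtain ⟨s, hs⟩ := rcAux_mat_exists hb k hk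
      exact ⟨s, fun _ => hs⟩
    · exact ⟨0, fun h => absurd h hk⟩
  choose ρ hρ using ra
  choose σ hσ using rb
  have eR : ∀ k, 1 ≤ k → R k = rcAuxPair (rcAuxPad N (ρ k)) 0 := by
    intro k hk
    refine rcAux_mat_unique (hR k hk).1
      (rcAux_pair_pos (rcAux_pad_pos N (hρ k hk).1) ⟨0, by simp⟩) k hk ?_
    rw [(hR k hk).2, rcAux_pair_pow, rcAux_pad_pow _ _ _ hk, (hρ k hk).2, zero_pow (by omega)]
  have eS : ∀ k, 1 ≤ k → S k = rcAuxPair (rcAuxPad N (σ k)) 1 := by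
    intro k hk
    refine rcAux_mat_unique (hS k hk).1
      (rcAux_pair_pos (rcAux_pad_pos N (hσ k hk).1) ⟨1, by simp⟩) k hk ?_
    rw [(hS k hk).2, rcAux_pair_pow, rcAux_pad_pow _ _ _ hk, (hσ k hk).2, one_pow]
  have hz : τ.toFun (0, 0) = 0 := map_zero τ.toFun
  have lR : Tendsto (fun k => (∑ i, τ.toFun (ρ k i i, 0)).re) atTop (nhds da) := by
    refine hRl.congr' ?_
    filter_upwards [eventually_ge_atTop 1] with k hk
    rw [eR k hk, rcAux_matTr_pair]
    simp [hz]
  have lS : Tendsto (fun k => (∑ i, τ.toFun (σ k i i, 0)).re) atTop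
      (nhds (db - (n + N : ℝ) * (1 - t))) := by
    refine (hSl.sub_const ((n + N : ℝ) * (1 - t))).congr' ?_
    filter_upwards [eventually_ge_atTop 1] with k hk
    rw [eS k hk, rcAux_matTr_pair]
    simp [ht']
    ring
  have hn : (0 : ℝ) ≤ n := Nat.cast_nonneg n
  rcases ht0.eq_or_lt with h0 | hpos
  · subst h0
    have vanish : ∀ s : Matrix (Fin n) (Fin n) A, IsPositiveEl s →
        (∑ i, τ.toFun (s i i, 0)).re = 0 := by
      rintro _ ⟨c, rfl⟩
      rw [Complex.re_sum]
      refine Finset.sum_eq_zero fun i _ => ?_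
      have e : (((star c * c) i i, 0) : A × B) = ∑ j, (star (c j i) * c j i, 0) := by
        ext <;> simp [Matrix.mul_apply, Matrix.star_apply, Prod.fst_sum, Prod.snd_sum]
      rw [e, map_sum, Complex.re_sum]
      exact Finset.sum_eq_zero fun j _ => rcAux_zero τ (by simpa using ht) _
    have h1 : da = 0 := by
      refine tendsto_nhds_unique lR (tendsto_const_nhds.congr' ?_)
      filter_upwards [eventually_ge_atTop 1] with k hk
      rw [vanish _ (hρ k hk).1]
    have h2 : db - (n + N : ℝ) * (1 - 0) = 0 := by
      refine tendsto_nhds_unique lS (tendsto_const_nhds.congr' ?_)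
      filter_upwards [eventually_ge_atTop 1] with k hk
      rw [vanish _ (hσ k hk).1]
    linarith
  · have tr : ∀ s : Matrix (Fin n) (Fin n) A,
        (matTr (rcAuxRestr τ t hpos ht) s).re = t⁻¹ * (∑ i, τ.toFun (s i i, 0)).re := by
      intro s
      rw [← Complex.re_ofReal_mul, Finset.mul_sum]
      rfl
    have := H (rcAuxRestr τ t hpos ht) (t⁻¹ * da) (t⁻¹ * (db - (n + N : ℝ) * (1 - t)))
      ⟨ρ, hρ, by simp_rw [tr]; exact lR.const_mul _⟩
      ⟨σ, hσ, by simp_rw [tr]; exact lS.const_mul _⟩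
    have h3 := mul_lt_mul_of_pos_left this hpos
    rw [mul_add, mul_inv_cancel_left₀ hpos.ne', mul_inv_cancel_left₀ hpos.ne'] at h3
    nlinarith [mul_nonneg hn ht1, mul_nonneg (sub_nonneg.2 hN.le) ht1]

theorem rcAux_fst {A B : Type*} [NormedRing A] [StarRing A] [CStarRing A]
    [NormedAlgebra ℂ A] [StarModule ℂ A] [CompleteSpace A]
    [NormedRing B] [StarRing B] [CStarRing B]
    [NormedAlgebra ℂ B] [StarModule ℂ B] [CompleteSpace B] (r : ℝ)
    (h : HasRComparison (A × B) r) : HasRComparison A r := by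
  intro n a b ha hb H
  obtain ⟨N, hN⟩ := exists_nat_gt r
  have key := h (n + N) (rcAuxPair (rcAuxPad N a) 0) (rcAuxPair (rcAuxPad N b) 1)
      (rcAux_pair_pos (rcAux_pad_pos N ha) ⟨0, by simp⟩)
      (rcAux_pair_pos (rcAux_pad_pos N hb) ⟨1, by simp⟩)
      (fun τ da db h1 h2 => rcAux_ineq r N hN n a b ha hb H τ da db h1 h2)
  have key2 := rcAux_cuntz_map (StarAlgHom.fst ℂ A B) continuous_fst key
  have e : ∀ (x : Matrix (Fin (n + N)) (Fin (n + N)) A) (y : Matrix (Fin (n + N)) (Fin (n + N)) B),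
      (rcAuxPair x y).map (StarAlgHom.fst ℂ A B) = x := fun x y => rfl
  rw [e, e] at key2
  exact rcAux_cuntz_pad N key2

theorem rcAux_prod {A B : Type*} [NormedRing A] [StarRing A] [CStarRing A]
    [NormedAlgebra ℂ A] [StarModule ℂ A] [CompleteSpace A]
    [NormedRing B] [StarRing B] [CStarRing B]
    [NormedAlgebra ℂ B] [StarModule ℂ B] [CompleteSpace B] (r : ℝ)
    (hA : HasRComparison A r) (hB : HasRComparison B r) : HasRComparison (A × B) r := by
  intro n a b ha hb H
  have eta : ∀ x : Matrix (Fin n) (Fin n) (A × B), rcAuxPair (x.map (StarAlgHom.fst ℂ A B))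
    (x.map (StarAlgHom.snd ℂ A B)) = x := fun x => rfl
  have liftA : ∀ (x : Matrix (Fin n) (Fin n) (A × B)) (_ : IsPositiveEl x) (τ : TracialState A)
      (l : ℝ), IsDTau τ (x.map (StarAlgHom.fst ℂ A B)) l →
      IsDTau (rcAuxPull τ (StarAlgHom.fst ℂ A B)) x l := by
    rintro x hx τ l ⟨R, hR, hl⟩
    have ex : ∀ k, ∃ s : Matrix (Fin n) (Fin n) B, 1 ≤ k → IsPositiveEl s ∧
        s ^ k = x.map (StarAlgHom.snd ℂ A B) := by
      intro k
      by_cases hk : 1 ≤ k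
      · obtain ⟨s, hs⟩ := rcAux_mat_exists (rcAux_pos_map (StarAlgHom.snd ℂ A B) hx) k hk
        exact ⟨s, fun _ => hs⟩
      · exact ⟨0, fun h => absurd h hk⟩
    choose S hS using ex
    refine ⟨fun k => rcAuxPair (R k) (S k), fun k hk =>
      ⟨rcAux_pair_pos (hR k hk).1 (hS k hk).1, ?_⟩, hl⟩
    rw [rcAux_pair_pow, (hR k hk).2, (hS k hk).2, eta]
  have liftB : ∀ (x : Matrix (Fin n) (Fin n) (A × B)) (_ : IsPositiveEl x) (τ : TracialState B)
      (l : ℝ), IsDTau τ (x.map (StarAlgHom.snd ℂ A B)) l →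
      IsDTau (rcAuxPull τ (StarAlgHom.snd ℂ A B)) x l := by
    rintro x hx τ l ⟨R, hR, hl⟩
    have ex : ∀ k, ∃ s : Matrix (Fin n) (Fin n) A, 1 ≤ k → IsPositiveEl s ∧
        s ^ k = x.map (StarAlgHom.fst ℂ A B) := by
      intro k
      by_cases hk : 1 ≤ k
      · obtain ⟨s, hs⟩ := rcAux_mat_exists (rcAux_pos_map (StarAlgHom.fst ℂ A B) hx) k hk
        exact ⟨s, fun _ => hs⟩
      · exact ⟨0, fun h => absurd h hk⟩
    choose S hS using ex
    refine ⟨fun k => rcAuxPair (S k) (R k), fun k hk =>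
      ⟨rcAux_pair_pos (hS k hk).1 (hR k hk).1, ?_⟩, hl⟩
    rw [rcAux_pair_pow, (hR k hk).2, (hS k hk).2, eta]
  obtain ⟨v, hv⟩ := hA n _ _ (rcAux_pos_map (StarAlgHom.fst ℂ A B) ha)
    (rcAux_pos_map (StarAlgHom.fst ℂ A B) hb)
    fun τ da db h1 h2 => H _ da db (liftA a ha τ da h1) (liftA b hb τ db h2)
  obtain ⟨w, hw⟩ := hB n _ _ (rcAux_pos_map (StarAlgHom.snd ℂ A B) ha)
    (rcAux_pos_map (StarAlgHom.snd ℂ A B) hb)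
    fun τ da db h1 h2 => H _ da db (liftB a ha τ da h1) (liftB b hb τ db h2)
  refine ⟨fun k => rcAuxPair (v k) (w k), ?_⟩
  have hc : Continuous fun p : Matrix (Fin n) (Fin n) A × Matrix (Fin n) (Fin n) B =>
      rcAuxPair p.1 p.2 :=
    continuous_matrix fun i j =>
      (continuous_fst.matrix_elem i j).prodMk (continuous_snd.matrix_elem i j)
  have := (hc.tendsto (a.map (StarAlgHom.fst ℂ A B), a.map (StarAlgHom.snd ℂ A B))).comp
    (hv.prodMk_nhds hw)
  refine this.congr fun k => ?_
  conv_rhs => rw [← eta b, rcAux_pair_star, rcAux_pair_mul, rcAux_pair_mul]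
  rfl

theorem rcAux_mono {A : Type*} [Ring A] [StarRing A] [Algebra ℂ A] [TopologicalSpace A]
    {r s : ℝ} (hrs : r ≤ s) (h : HasRComparison A r) : HasRComparison A s :=
  fun n a b ha hb H => h n a b ha hb fun τ da db h1 h2 => by
    linarith [H τ da db h1 h2]

end main


/-- for unital stably finite C*-algebras `A` and `B`,
`rc(A ⊕ B) = max{rc(A), rc(B)}`. -/
theorem rc_prod_eq_max (A B : Type*) [NormedRing A] [StarRing A] [CStarRing A]
    [NormedAlgebra ℂ A] [StarModule ℂ A] [CompleteSpace A]
    [NormedRing B] [StarRing B] [CStarRing B]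
    [NormedAlgebra ℂ B] [StarModule ℂ B] [CompleteSpace B]
    (hA : StablyFinite A) (hB : StablyFinite B) :
    radiusOfComparison (A × B) = max (radiusOfComparison A) (radiusOfComparison B) := by
  apply le_antisymm
  · refine le_of_forall_gt fun c hc => ?_
    obtain ⟨h1, h2⟩ := max_lt_iff.1 hc
    obtain ⟨⟨r, hr0, hr⟩, hrc⟩ := iInf_lt_iff.1 h1
    obtain ⟨⟨s, hs0, hs⟩, hsc⟩ := iInf_lt_iff.1 h2
    refine iInf_lt_iff.2 ⟨⟨max r s, le_max_of_le_left hr0,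
      rcAux_prod _ (rcAux_mono (le_max_left _ _) hr) (rcAux_mono (le_max_right _ _) hs)⟩, ?_⟩
    rcases max_choice r s with h | h
    · simpa [h] using hrc
    · simpa [h] using hsc
  · refine le_iInf fun ⟨r, hr0, hr⟩ => max_le ?_ ?_
    · exact iInf_le_of_le ⟨r, hr0, rcAux_fst r hr⟩ le_rfl
    · exact iInf_le_of_le ⟨r, hr0, rcAux_fst r (rcAux_swap r hr)⟩ le_rfl
end

section
/- Let A be a unital stably finite C*-algebra and n ∈ ℕ, n ≥ 1. Then rc(M_n ⊗ A) = (1/n)·rc(A). -/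
open Filter Topology
open scoped ENNReal

section Helpers

open scoped ComplexOrder

theorem h_nonneg {B : Type*} [CStarAlgebra B] [PartialOrder B] [StarOrderedRing B] {n : ℕ}
    (c : Fin n → B) : ∃ d, ∑ l, star (c l) * c l = star d * d :=
  CStarAlgebra.nonneg_iff_eq_star_mul_self.mp
    (Finset.sum_nonneg fun l _ => star_mul_self_nonneg (c l))

theorem h_posSum {A : Type*} [CStarAlgebra A] {m n : ℕ}
    (c : Fin n → Matrix (Fin m) (Fin m) A) :
    IsPositiveEl (∑ l, star (c l) * c l) := by
  let _ := CStarAlgebra.spectralOrder A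
  have := CStarAlgebra.spectralOrderedRing A
  let c' : Fin n → CStarMatrix (Fin m) (Fin m) A := fun l => CStarMatrix.ofMatrix (c l)
  obtain ⟨d, hd⟩ := h_nonneg c'
  exact ⟨CStarMatrix.ofMatrix.symm d, hd⟩

theorem h_starMulZero {A : Type*} [CStarAlgebra A] {m : ℕ}
    (c : Matrix (Fin m) (Fin m) A) (h : star c * c = 0) : c = 0 := by
  let _ := CStarAlgebra.spectralOrder A
  have := CStarAlgebra.spectralOrderedRing A
  exact (CStarRing.star_mul_self_eq_zero_iff
    (CStarMatrix.ofMatrix c : CStarMatrix (Fin m) (Fin m) A)).mp h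

/-- `M_m(M_n(A)) ≃ M_{mn}(A)`. -/
def flat (A : Type*) [Ring A] (m n : ℕ) :
    Matrix (Fin m) (Fin m) (Matrix (Fin n) (Fin n) A) ≃+*
      Matrix (Fin (m * n)) (Fin (m * n)) A :=
  (Matrix.compRingEquiv (Fin m) (Fin n) A).trans
    (Matrix.reindexRingEquiv A finProdFinEquiv)

theorem flat_apply {A : Type*} [Ring A] {m n : ℕ}
    (M : Matrix (Fin m) (Fin m) (Matrix (Fin n) (Fin n) A)) (i j) :
    flat A m n M i j = M (finProdFinEquiv.symm i).1 (finProdFinEquiv.symm j).1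
      (finProdFinEquiv.symm i).2 (finProdFinEquiv.symm j).2 := rfl

theorem flat_symm_apply {A : Type*} [Ring A] {m n : ℕ}
    (M : Matrix (Fin (m * n)) (Fin (m * n)) A) (i j k l) :
    (flat A m n).symm M i j k l = M (finProdFinEquiv (i, k)) (finProdFinEquiv (j, l)) := rfl

theorem flat_star {A : Type*} [Ring A] [StarRing A] {m n : ℕ}
    (M : Matrix (Fin m) (Fin m) (Matrix (Fin n) (Fin n) A)) :
    flat A m n (star M) = star (flat A m n M) := by
  ext i j
  simp [flat_apply, Matrix.star_apply]

theorem flat_symm_star {A : Type*} [Ring A] [StarRing A] {m n : ℕ}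
    (M : Matrix (Fin (m * n)) (Fin (m * n)) A) :
    (flat A m n).symm (star M) = star ((flat A m n).symm M) := by
  apply (flat A m n).injective
  simp [flat_star]

theorem flat_symm_continuous {A : Type*} [Ring A] [TopologicalSpace A] {m n : ℕ} :
    Continuous (flat A m n).symm := by
  refine continuous_matrix fun i j => continuous_matrix fun k l => ?_
  simp only [flat_symm_apply]
  exact continuous_id.matrix_elem _ _

theorem flat_pos {A : Type*} [Ring A] [StarRing A] {m n : ℕ}
    {a : Matrix (Fin m) (Fin m) (Matrix (Fin n) (Fin n) A)} (h : IsPositiveEl a) :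
    IsPositiveEl (flat A m n a) := by
  obtain ⟨c, rfl⟩ := h
  exact ⟨flat A m n c, by simp [flat_star]⟩

theorem flat_symm_pos {A : Type*} [Ring A] [StarRing A] {m n : ℕ}
    {a : Matrix (Fin (m * n)) (Fin (m * n)) A} (h : IsPositiveEl a) :
    IsPositiveEl ((flat A m n).symm a) := by
  obtain ⟨c, rfl⟩ := h
  exact ⟨(flat A m n).symm c, by simp [flat_symm_star]⟩

/-- The normalized trace extension of a tracial state. -/
noncomputable def TracialState.up {A : Type*} [Ring A] [StarRing A] [Algebra ℂ A] (τ : TracialState A)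
    (n : ℕ) (hn : 1 ≤ n) : TracialState (Matrix (Fin n) (Fin n) A) where
  toFun := ((n : ℂ)⁻¹) • ∑ i, τ.toFun ∘ₗ Matrix.entryLinearMap ℂ A i i
  map_one' := by
    have : (n : ℂ) ≠ 0 := by exact_mod_cast (by omega : n ≠ 0)
    simp [τ.map_one', this]
  pos' := fun a => by
    have h : ∀ i, 0 ≤ τ.toFun ((star a * a) i i) := fun i => by
      rw [Matrix.mul_apply, map_sum]
      refine Finset.sum_nonneg fun k _ => ?_
      rw [Matrix.star_apply, Complex.nonneg_iff]
      exact ⟨(τ.pos' _).1, (τ.pos' _).2.symm⟩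
    have h2 : 0 ≤ (((n : ℂ)⁻¹) • ∑ i, τ.toFun ∘ₗ Matrix.entryLinearMap ℂ A i i) (star a * a) := by
      simp only [LinearMap.smul_apply, LinearMap.sum_apply, LinearMap.comp_apply,
        Matrix.entryLinearMap_apply, smul_eq_mul]
      refine mul_nonneg ?_ (Finset.sum_nonneg fun i _ => h i)
      have : (0:ℂ) ≤ n := by exact_mod_cast Nat.zero_le n
      exact inv_nonneg.mpr this
    rw [Complex.nonneg_iff] at h2
    exact ⟨h2.1, h2.2.symm⟩
  tracial' := fun a b => by
    simp only [LinearMap.smul_apply, LinearMap.sum_apply, LinearMap.comp_apply,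
      Matrix.entryLinearMap_apply, smul_eq_mul, Matrix.mul_apply, map_sum]
    rw [Finset.sum_comm]
    simp only [fun i j => τ.tracial' (a i j) (b j i)]

theorem up_apply {A : Type*} [Ring A] [StarRing A] [Algebra ℂ A] (τ : TracialState A)
    (n : ℕ) (hn : 1 ≤ n) (M : Matrix (Fin n) (Fin n) A) :
    (τ.up n hn).toFun M = (n : ℂ)⁻¹ * ∑ i, τ.toFun (M i i) := by
  simp [TracialState.up]

theorem matTr_up {A : Type*} [Ring A] [StarRing A] [Algebra ℂ A] (τ : TracialState A)
    {n m : ℕ} (hn : 1 ≤ n) (M : Matrix (Fin (m * n)) (Fin (m * n)) A) :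
    matTr (τ.up n hn) ((flat A m n).symm M) = (n : ℂ)⁻¹ * matTr τ M := by
  simp only [matTr, up_apply, flat_symm_apply]
  rw [← Finset.mul_sum, ← Fintype.sum_prod_type', ← finProdFinEquiv.sum_comp]

theorem dtau_up {A : Type*} [Ring A] [StarRing A] [Algebra ℂ A]
    (τ : TracialState A) {n m : ℕ} (hn : 1 ≤ n)
    (a : Matrix (Fin m) (Fin m) (Matrix (Fin n) (Fin n) A)) (l : ℝ)
    (h : IsDTau τ (flat A m n a) l) : IsDTau (τ.up n hn) a ((n : ℝ)⁻¹ * l) := by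
  obtain ⟨root, h1, h2⟩ := h
  refine ⟨fun k => (flat A m n).symm (root k), fun k hk => ⟨flat_symm_pos (h1 k hk).1, ?_⟩, ?_⟩
  · rw [← map_pow, (h1 k hk).2, RingEquiv.symm_apply_apply]
  · simp only [matTr_up]
    have : ∀ z : ℂ, ((n : ℂ)⁻¹ * z).re = (n : ℝ)⁻¹ * z.re := fun z => by
      rw [← Complex.ofReal_natCast, ← Complex.ofReal_inv, Complex.re_ofReal_mul]
    simp only [this]
    exact h2.const_mul _

theorem comparison_up {A : Type*} [Ring A] [StarRing A] [Algebra ℂ A] [TopologicalSpace A]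
    {n : ℕ} (hn : 1 ≤ n) {r : ℝ} (h : HasRComparison A (n * r)) :
    HasRComparison (Matrix (Fin n) (Fin n) A) r := by
  intro m a b ha hb hab
  have hn0 : (0:ℝ) < n := by exact_mod_cast hn
  obtain ⟨v, hv⟩ := h (m * n) (flat A m n a) (flat A m n b) (flat_pos ha) (flat_pos hb) (by
    intro τ da db hda hdb
    have := hab (τ.up n hn) _ _ (dtau_up τ hn a da hda) (dtau_up τ hn b db hdb)
    have h3 := mul_lt_mul_of_pos_left this hn0
    rw [mul_add, mul_inv_cancel_left₀ hn0.ne', mul_inv_cancel_left₀ hn0.ne'] at h3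
    exact h3)
  refine ⟨fun k => (flat A m n).symm (v k), ?_⟩
  have := (flat_symm_continuous.tendsto _).comp hv
  simpa [Function.comp_def, flat_symm_star] using this

/-- Corner embedding. -/
def emb {A : Type*} [Ring A] {n m : ℕ} (z : Fin n) (a : Matrix (Fin m) (Fin m) A) :
    Matrix (Fin m) (Fin m) (Matrix (Fin n) (Fin n) A) :=
  Matrix.of fun i j => Matrix.single z z (a i j)

/-- Corner compression. -/
def cor {A : Type*} {n m : ℕ} (z : Fin n)
    (M : Matrix (Fin m) (Fin m) (Matrix (Fin n) (Fin n) A)) : Matrix (Fin m) (Fin m) A :=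
  Matrix.of fun i j => M i j z z

theorem emb_mul {A : Type*} [Ring A] {n m : ℕ} (z : Fin n) (a b : Matrix (Fin m) (Fin m) A) :
    emb z (a * b) = emb z a * emb z b := by
  ext i j k l
  simp only [emb, Matrix.of_apply, Matrix.mul_apply, Matrix.single_mul_single_same,
    Matrix.sum_apply]
  simp [Matrix.single_apply]

theorem emb_star {A : Type*} [Ring A] [StarRing A] {n m : ℕ} (z : Fin n)
    (a : Matrix (Fin m) (Fin m) A) : emb z (star a) = star (emb z a) := by
  ext i j k l
  simp only [emb, Matrix.of_apply, Matrix.star_apply, Matrix.single_apply, and_comm]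
  rw [apply_ite star, star_zero]

theorem cor_emb {A : Type*} [Ring A] {n m : ℕ} (z : Fin n)
    (a : Matrix (Fin m) (Fin m) A) : cor z (emb z a) = a := by
  ext i j
  simp [cor, emb]

theorem emb_pos {A : Type*} [Ring A] [StarRing A] {m n : ℕ} (z : Fin n)
    {a : Matrix (Fin m) (Fin m) A} (h : IsPositiveEl a) : IsPositiveEl (emb z a) := by
  obtain ⟨c, rfl⟩ := h
  exact ⟨emb z c, by rw [emb_mul, emb_star]⟩

theorem cor_emb_mul {A : Type*} [Ring A] {n m : ℕ} (z : Fin n)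
    (b : Matrix (Fin m) (Fin m) A) (M : Matrix (Fin m) (Fin m) (Matrix (Fin n) (Fin n) A)) :
    cor z (emb z b * M) = b * cor z M := by
  ext i j
  simp [cor, emb, Matrix.mul_apply, Matrix.sum_apply, Matrix.single_apply]

theorem cor_mul_emb {A : Type*} [Ring A] {n m : ℕ} (z : Fin n)
    (b : Matrix (Fin m) (Fin m) A) (M : Matrix (Fin m) (Fin m) (Matrix (Fin n) (Fin n) A)) :
    cor z (M * emb z b) = cor z M * b := by
  ext i j
  simp [cor, emb, Matrix.mul_apply, Matrix.sum_apply, Matrix.single_apply]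

theorem cor_mid {A : Type*} [Ring A] {n m : ℕ} (z : Fin n)
    (b : Matrix (Fin m) (Fin m) A) (M N : Matrix (Fin m) (Fin m) (Matrix (Fin n) (Fin n) A)) :
    cor z (M * emb z b * N) = cor z M * b * cor z N := by
  have h : ∀ i j k : Fin m, ∀ y, (M * emb z b) i k z y = if z = y then (cor z M * b) i k else 0 := by
    intro i j k y
    by_cases hy : z = y
    · subst hy
      rw [← cor_mul_emb]
      simp [cor]
    · simp [emb, Matrix.mul_apply, Matrix.sum_apply, Matrix.single_apply, hy]
  ext i j
  rw [Matrix.mul_apply]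
  simp only [cor, Matrix.of_apply]
  rw [Matrix.mul_apply, Matrix.sum_apply]
  refine Finset.sum_congr rfl fun k _ => ?_
  rw [Matrix.mul_apply]
  simp only [h i j]
  simp [cor]

theorem cor_star {A : Type*} [Ring A] [StarRing A] {n m : ℕ} (z : Fin n)
    (M : Matrix (Fin m) (Fin m) (Matrix (Fin n) (Fin n) A)) :
    cor z (star M) = star (cor z M) := by
  ext i j
  simp [cor, Matrix.star_apply]

theorem cor_continuous {A : Type*} [Ring A] [TopologicalSpace A] {n m : ℕ} (z : Fin n) :
    Continuous (cor z : Matrix (Fin m) (Fin m) (Matrix (Fin n) (Fin n) A) → _) := by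
  refine continuous_matrix fun i j => ?_
  exact (continuous_id.matrix_elem i j).matrix_elem z z

theorem cor_pos {A : Type*} [CStarAlgebra A] {n m : ℕ} (z : Fin n)
    {M : Matrix (Fin m) (Fin m) (Matrix (Fin n) (Fin n) A)} (h : IsPositiveEl M) :
    IsPositiveEl (cor z M) := by
  obtain ⟨c, rfl⟩ := h
  have : cor z (star c * c) = ∑ l : Fin n, star (Matrix.of fun i j => c i j l z) *
      (Matrix.of fun i j => c i j l z) := by
    ext i j
    simp only [cor, Matrix.of_apply, Matrix.mul_apply, Matrix.sum_apply, Matrix.star_apply]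
    rw [Finset.sum_comm]
  rw [this]
  exact h_posSum _

theorem emb_cor {A : Type*} [Ring A] {n m : ℕ} (z : Fin n)
    (M : Matrix (Fin m) (Fin m) (Matrix (Fin n) (Fin n) A)) 
    (h1 : M * emb z 1 = M) (h2 : emb z 1 * M = M) : emb z (cor z M) = M := by
  have e1 : ∀ i j k l, M i j k l = if z = l then M i j k z else 0 := by
    intro i j k l
    conv_lhs => rw [← h1]
    rw [Matrix.mul_apply, Matrix.sum_apply, Finset.sum_eq_single j]
    · by_cases h : z = l
      · subst h
        simp [emb]
      · simp [emb, Matrix.mul_apply, Matrix.single_apply, h]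
    · intro x _ hx
      simp [emb, Matrix.one_apply, hx]
    · simp
  have e2 : ∀ i j k l, M i j k l = if z = k then M i j z l else 0 := by
    intro i j k l
    conv_lhs => rw [← h2]
    rw [Matrix.mul_apply, Matrix.sum_apply, Finset.sum_eq_single i]
    · by_cases h : z = k
      · subst h
        simp [emb]
      · simp [emb, Matrix.mul_apply, Matrix.single_apply, h]
    · intro x _ hx
      simp [emb, Matrix.one_apply, Ne.symm hx]
    · simp
  ext i j k l
  rw [e1 i j k l, e2 i j k z]
  simp only [emb, cor, Matrix.of_apply, Matrix.single_apply]
  clear e1 e2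
  by_cases hl : z = l
  · by_cases hk : z = k
    · rw [if_pos ⟨hk, hl⟩, if_pos hl, if_pos hk]
    · rw [if_neg (fun h => hk h.1), if_pos hl, if_neg hk]
  · rw [if_neg (fun h => hl h.2), if_neg hl]

theorem h_flatZero {A : Type*} [CStarAlgebra A] {m n : ℕ}
    (c : Matrix (Fin m) (Fin m) (Matrix (Fin n) (Fin n) A)) (h : star c * c = 0) : c = 0 := by
  apply (flat A m n).injective
  rw [map_zero]
  apply h_starMulZero
  rw [← flat_star, ← map_mul, h, map_zero]

theorem h_powZero {A : Type*} [CStarAlgebra A] {m n : ℕ}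
    (x y : Matrix (Fin m) (Fin m) (Matrix (Fin n) (Fin n) A)) (hx : star x = x) (k : ℕ)
    (h : x ^ (k + 1) * y = 0) : x * y = 0 := by
  induction k with
  | zero => simpa using h
  | succ k ih =>
    apply ih
    apply h_flatZero
    rw [star_mul, star_pow, hx, mul_assoc, ← mul_assoc (x ^ (k + 1)), ← pow_add,
      show k + 1 + (k + 1) = k + (k + 1 + 1) by ring, pow_add, mul_assoc, h, mul_zero, mul_zero]

theorem root_corner {A : Type*} [CStarAlgebra A] {m n : ℕ} (z : Fin n)
    (a : Matrix (Fin m) (Fin m) A) (x : Matrix (Fin m) (Fin m) (Matrix (Fin n) (Fin n) A))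
    (hx : IsPositiveEl x) (k : ℕ) (h : x ^ (k + 1) = emb z a) : emb z (cor z x) = x := by
  have hs : star x = x := by
    obtain ⟨c, rfl⟩ := hx
    simp
  have h1 : x * emb z 1 = x := by
    have : x * (1 - emb z 1) = 0 := h_powZero x _ hs k (by
      rw [h, mul_sub, mul_one, ← emb_mul, mul_one, sub_self])
    rw [mul_sub, mul_one, sub_eq_zero] at this
    exact this.symm
  refine emb_cor z x h1 ?_
  have := congrArg star h1
  rwa [star_mul, hs, ← emb_star, star_one] at this

theorem emb_pow {A : Type*} [Ring A] {n m : ℕ} (z : Fin n) (a : Matrix (Fin m) (Fin m) A) (k : ℕ) :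
    emb z (a ^ (k + 1)) = emb z a ^ (k + 1) := by
  induction k with
  | zero => simp
  | succ k ih => rw [pow_succ, emb_mul, ih, ← pow_succ]

theorem trace_single {A : Type*} [Ring A] [StarRing A] [Algebra ℂ A] {n : ℕ}
    (τ : TracialState (Matrix (Fin n) (Fin n) A)) (i z : Fin n) :
    τ.toFun (Matrix.single i i 1) = τ.toFun (Matrix.single z z 1) := by
  have := τ.tracial' (Matrix.single i z 1) (Matrix.single z i 1)
  simpa using this

/-- Restriction of a tracial state to the corner. -/
noncomputable def TracialState.down {A : Type*} [Ring A] [StarRing A] [Algebra ℂ A] {n : ℕ}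
    (τ : TracialState (Matrix (Fin n) (Fin n) A)) (z : Fin n) : TracialState A where
  toFun := (n : ℂ) • τ.toFun ∘ₗ Matrix.singleLinearMap ℂ z z
  map_one' := by
    have h : (1 : Matrix (Fin n) (Fin n) A) = ∑ i, Matrix.single i i 1 := by
      ext i j
      rw [Matrix.sum_apply, Finset.sum_eq_single i]
      · simp [Matrix.single_apply, Matrix.one_apply]
      · intro x _ hx
        simp [Matrix.single_apply, hx]
      · simp
    have h2 := τ.map_one'
    rw [h, map_sum, Finset.sum_congr rfl fun i _ => trace_single τ i z] at h2
    simpa using h2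
  pos' := fun a => by
    have h := τ.pos' (Matrix.single z z a)
    have e : star (Matrix.single z z a) = Matrix.single z z (star a) := by
      rw [Matrix.star_eq_conjTranspose, Matrix.conjTranspose_single]
    rw [e, Matrix.single_mul_single_same] at h
    simp [h.2]
    exact mul_nonneg (Nat.cast_nonneg n) h.1
  tracial' := fun a b => by
    have := τ.tracial' (Matrix.single z z a) (Matrix.single z z b)
    simp only [Matrix.single_mul_single_same] at this
    simp [this]

theorem down_apply {A : Type*} [Ring A] [StarRing A] [Algebra ℂ A] {n : ℕ}
    (τ : TracialState (Matrix (Fin n) (Fin n) A)) (z : Fin n) (a : A) :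
    (τ.down z).toFun a = n * τ.toFun (Matrix.single z z a) := by
  simp [TracialState.down]

theorem matTr_down {A : Type*} [Ring A] [StarRing A] [Algebra ℂ A] {n m : ℕ}
    (τ : TracialState (Matrix (Fin n) (Fin n) A)) (z : Fin n) (a : Matrix (Fin m) (Fin m) A) :
    matTr (τ.down z) a = n * matTr τ (emb z a) := by
  simp [matTr, down_apply, emb, Finset.mul_sum]

theorem dtau_down {A : Type*} [CStarAlgebra A] {n m : ℕ}
    (τ : TracialState (Matrix (Fin n) (Fin n) A)) (z : Fin n) (a : Matrix (Fin m) (Fin m) A)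
    (l : ℝ) (h : IsDTau τ (emb z a) l) : IsDTau (τ.down z) a (n * l) := by
  obtain ⟨root, h1, h2⟩ := h
  have hc : ∀ k, 1 ≤ k → emb z (cor z (root k)) = root k := by
    intro k hk
    obtain ⟨k, rfl⟩ := Nat.exists_eq_add_of_le' hk
    exact root_corner z a _ (h1 _ hk).1 k (h1 _ hk).2
  refine ⟨fun k => cor z (root k), fun k hk => ⟨cor_pos z (h1 k hk).1, ?_⟩, ?_⟩
  · have h3 := (h1 k hk).2
    rw [← hc k hk] at h3
    obtain ⟨k, rfl⟩ := Nat.exists_eq_add_of_le' hk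
    rw [← emb_pow] at h3
    have := congrArg (cor z) h3
    rwa [cor_emb, cor_emb] at this
  · refine (h2.const_mul (n : ℝ)).congr' ?_
    filter_upwards [eventually_ge_atTop 1] with k hk
    rw [matTr_down, hc k hk, ← Complex.ofReal_natCast, Complex.re_ofReal_mul]

theorem comparison_down {A : Type*} [CStarAlgebra A]
    {n : ℕ} (hn : 1 ≤ n) {r : ℝ} (h : HasRComparison (Matrix (Fin n) (Fin n) A) r) :
    HasRComparison A (n * r) := by
  intro m a b ha hb hab
  have hn0 : (0:ℝ) < n := by exact_mod_cast hn
  let z : Fin n := ⟨0, hn⟩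
  obtain ⟨v, hv⟩ := h m (emb z a) (emb z b) (emb_pos z ha) (emb_pos z hb) (by
    intro τ da db hda hdb
    have := hab (τ.down z) _ _ (dtau_down τ z a da hda) (dtau_down τ z b db hdb)
    rw [← mul_add] at this
    exact lt_of_mul_lt_mul_left this hn0.le)
  refine ⟨fun k => cor z (v k), ?_⟩
  have := ((cor_continuous z).tendsto _).comp hv
  simpa [Function.comp_def, cor_mid, cor_star, cor_emb] using this

theorem rc_matrix_aux (A : Type*) [CStarAlgebra A] (n : ℕ) (hn : 1 ≤ n) :
    radiusOfComparison (Matrix (Fin n) (Fin n) A) =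
      ((n : ℝ≥0∞))⁻¹ * radiusOfComparison A := by
  have hn0 : (0:ℝ) < n := by exact_mod_cast hn
  have hne : (n : ℝ≥0∞) ≠ 0 := by exact_mod_cast (by omega : n ≠ 0)
  have hnt : (n : ℝ≥0∞) ≠ ⊤ := ENNReal.natCast_ne_top n
  have key : ∀ r : ℝ, 0 ≤ r → ENNReal.ofReal (n * r) = n * ENNReal.ofReal r := fun r hr => by
    rw [ENNReal.ofReal_mul hn0.le, ENNReal.ofReal_natCast]
  unfold radiusOfComparison
  rw [ENNReal.mul_iInf_of_ne (ENNReal.inv_ne_zero.mpr hnt) (ENNReal.inv_ne_top.mpr hne)]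
  apply le_antisymm
  · refine le_iInf fun ⟨r, hr, h⟩ => ?_
    have e : (n : ℝ) * (r / n) = r := by field_simp
    refine (iInf_le _ ⟨r / n, by positivity, comparison_up hn (by rwa [e])⟩).trans ?_
    have := key (r / n) (by positivity)
    rw [e] at this
    simp only [this]
    rw [← mul_assoc, ENNReal.inv_mul_cancel hne hnt, one_mul]
  · refine le_iInf fun ⟨r, hr, h⟩ => ?_
    refine (iInf_le _ ⟨n * r, by positivity, comparison_down hn h⟩).trans ?_
    simp only [key r hr]
    rw [← mul_assoc, ENNReal.inv_mul_cancel hne hnt, one_mul]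

end Helpers

/-- for a unital stably finite C*-algebra `A` and `n ≥ 1`,
`rc(M_n ⊗ A) = (1/n)·rc(A)`. -/
theorem rc_matrix (A : Type*) [NormedRing A] [StarRing A] [CStarRing A]
    [NormedAlgebra ℂ A] [StarModule ℂ A] [CompleteSpace A]
    (hA : StablyFinite A) (n : ℕ) (hn : 1 ≤ n) :
    radiusOfComparison (Matrix (Fin n) (Fin n) A) =
      ((n : ℝ≥0∞))⁻¹ * radiusOfComparison A := by
  let _ : CStarAlgebra A :=
    { (inferInstance : NormedRing A), (inferInstance : StarRing A),
      (inferInstance : CompleteSpace A), (inferInstance : CStarRing A),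
      (inferInstance : NormedAlgebra ℂ A), (inferInstance : StarModule ℂ A) with }
  exact rc_matrix_aux A n hn
end
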